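/- (Property 2.) Let N ≥ 3, σ > 0, μ ∈ ℝ, and suppose Y_i = μ + ε_i with ε_i i.i.d. N(0,σ²), i = 1,…,N. Let B be the (N−1)×N finite-difference matrix and let λ_N = (σ/2)√(N·log log N) be the universal threshold. Then the TV estimate computed from Y with threshold λ_N equals the constant fit with probability at least 1 − α_N, where α_N = 2/√(log N): ℙ( f̂_{λ_N}(Y) = Ȳ𝟙 ) ≥ 1 − 2/√(log N). -/

import Mathlib

open Matrix MeasureTheory ProbabilityTheory

/-- The total variation objective `F(f) = (1/2)‖y − f‖₂² + λ‖Bf‖₁`. -/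
noncomputable def tvF {P M : ℕ} (B : Matrix (Fin P) (Fin M) ℝ) (lam : ℝ)
    (y f : Fin M → ℝ) : ℝ :=
  (1 / 2) * ∑ i, (y i - f i) ^ 2 + lam * ∑ j, |B.mulVec f j|

/-- The `(N−1)×N` finite-difference matrix of dimension one:
row `i` has `+1` in column `i` and `−1` in column `i+1`. -/
def oneDiff (N : ℕ) : Matrix (Fin (N - 1)) (Fin N) ℝ :=
  fun i j => if (j : ℕ) = (i : ℕ) then 1 else if (j : ℕ) = (i : ℕ) + 1 then -1 else 0

theorem abel_range (n : ℕ) (z f : ℕ → ℝ) :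
    ∑ i ∈ Finset.range (n + 1), z i * f i
      = ∑ i ∈ Finset.range n, (∑ j ∈ Finset.range (i + 1), z j) * (f i - f (i + 1))
        + (∑ j ∈ Finset.range (n + 1), z j) * f n := by
  induction n with
  | zero => simp
  | succ n ih =>
    rw [Finset.sum_range_succ, ih, Finset.sum_range_succ (fun i => (∑ j ∈ Finset.range (i + 1), z j) * (f i - f (i + 1))),
      Finset.sum_range_succ z (n + 1)]
    ring

theorem oneDiff_mulVec (n : ℕ) (f : Fin (n + 1) → ℝ) (i : Fin n) :
    (oneDiff (n + 1)).mulVec f i = f i.castSucc - f i.succ := by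
  have h : ∀ j : Fin (n + 1), oneDiff (n + 1) i j * f j
      = (if j = i.castSucc then f j else 0) - (if j = i.succ then f j else 0) := by
    intro j
    simp only [oneDiff, Fin.ext_iff, Fin.val_castSucc, Fin.val_succ]
    split_ifs <;> first | omega | simp
  simp only [Matrix.mulVec, dotProduct]
  rw [Finset.sum_congr rfl fun j _ => h j]
  simp

/-- Deterministic part: small bridge implies that the constant fit minimizes. -/
theorem tv_det (N : ℕ) (hN : 0 < N) (lam : ℝ) (y : Fin N → ℝ)
    (h : ∀ k < N, |(∑ i : Fin N, if (i : ℕ) < k then y i else 0) - k / N * ∑ i, y i| ≤ lam)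
    (f : Fin N → ℝ) :
    tvF (oneDiff N) lam y (fun _ => (∑ k, y k) / (N : ℝ)) ≤ tvF (oneDiff N) lam y f := by
  obtain ⟨n, rfl⟩ : ∃ n, N = n + 1 := ⟨N - 1, by omega⟩
  set m := (∑ k, y k) / ((n + 1 : ℕ) : ℝ) with hm
  have hn0 : ((n + 1 : ℕ) : ℝ) ≠ 0 := by positivity
  have hmN : ((n + 1 : ℕ) : ℝ) * m = ∑ k, y k := by rw [hm]; field_simp
  -- extend to naturals
  let y' : ℕ → ℝ := fun k => if hk : k < n + 1 then y ⟨k, hk⟩ else 0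
  let f' : ℕ → ℝ := fun k => if hk : k < n + 1 then f ⟨k, hk⟩ else 0
  have hy' : ∀ i : Fin (n + 1), y' i = y i := fun i => by simp only [y', i.isLt, dite_true]
  have hf' : ∀ i : Fin (n + 1), f' i = f i := fun i => by simp only [f', i.isLt, dite_true]
  have hpart : ∀ k ≤ n + 1, (∑ i : Fin (n + 1), if (i : ℕ) < k then y i else 0)
      = ∑ j ∈ Finset.range k, y' j := by
    intro k hk
    rw [Finset.sum_congr rfl fun (i : Fin (n+1)) _ => by rw [← hy' i],
      Fin.sum_univ_eq_sum_range (fun i => if i < k then y' i else 0) (n + 1), ← Finset.sum_filter]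
    congr 1
    ext i
    simp
    omega
  have hS : ∑ i, y i = ∑ j ∈ Finset.range (n + 1), y' j := by
    rw [← hpart (n + 1) le_rfl]
    exact Finset.sum_congr rfl fun i _ => by rw [if_pos i.isLt]
  have hZ : ∀ k, ∑ j ∈ Finset.range k, (y' j - m) = (∑ j ∈ Finset.range k, y' j) - k * m := by
    intro k; rw [Finset.sum_sub_distrib]; simp
  have habel : ∑ i : Fin (n + 1), (y i - m) * f i
      = ∑ i : Fin n, (∑ j ∈ Finset.range ((i : ℕ) + 1), (y' j - m)) * (f i.castSucc - f i.succ) := by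
    have h0 := abel_range n (fun i => y' i - m) f'
    rw [hZ (n + 1), ← hS, hmN, sub_self, zero_mul, add_zero] at h0
    rw [← Fin.sum_univ_eq_sum_range (fun i => (y' i - m) * f' i), ← Fin.sum_univ_eq_sum_range
      (fun i => (∑ j ∈ Finset.range (i + 1), (y' j - m)) * (f' i - f' (i + 1)))] at h0
    calc _ = _ := Finset.sum_congr rfl fun i _ => by rw [← hy', ← hf']
      _ = _ := h0
      _ = _ := Finset.sum_congr rfl fun i _ => by
        rw [← hf' i.castSucc, ← hf' i.succ]; rfl
  have hbound : ∑ i : Fin (n + 1), (y i - m) * f i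
      ≤ lam * ∑ i : Fin n, |f i.castSucc - f i.succ| := by
    rw [habel, Finset.mul_sum]
    refine Finset.sum_le_sum fun i _ => ?_
    refine (le_abs_self _).trans ?_
    rw [abs_mul]
    refine mul_le_mul_of_nonneg_right ?_ (abs_nonneg _)
    have := h (i + 1) (by omega)
    rw [hpart (i + 1) (by omega)] at this
    have e : ((i + 1 : ℕ) : ℝ) / ((n + 1 : ℕ) : ℝ) * ∑ i, y i = ((i + 1 : ℕ) : ℝ) * m := by
      rw [hm]; ring
    rw [hZ, ← e]
    exact this
  have hsum0 : ∑ i : Fin (n + 1), (y i - m) = 0 := by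
    rw [Finset.sum_sub_distrib, ← hmN]; simp
  have hsq : ∑ i, (y i - f i) ^ 2 = ∑ i, (y i - m) ^ 2 + ∑ i, (f i - m) ^ 2
      - 2 * ∑ i, (y i - m) * f i + 2 * m * ∑ i, (y i - m) := by
    simp only [Finset.mul_sum, ← Finset.sum_add_distrib, ← Finset.sum_sub_distrib]
    exact Finset.sum_congr rfl fun i _ => by ring
  have hT : ∀ g : Fin (n + 1) → ℝ, ∑ j, |(oneDiff (n + 1)).mulVec g j|
      = ∑ i : Fin n, |g i.castSucc - g i.succ| := fun g =>
    Finset.sum_congr rfl fun i _ => by rw [← oneDiff_mulVec]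
  have hnn : 0 ≤ ∑ i, (f i - m) ^ 2 := Finset.sum_nonneg fun i _ => sq_nonneg _
  simp only [tvF]
  rw [hT, hT, hsq, hsum0]
  simp only [sub_self, abs_zero, Finset.sum_const_zero]
  linarith

/-- Vectors representing `(N S_k - k S_N)/(N-k)`. -/
noncomputable def bridgeVec (N k : ℕ) (i : Fin N) : ℝ :=
  N / (N - k) * (if (i : ℕ) < k then 1 else 0) - k / (N - k)

theorem sum_ind (N k : ℕ) (hk : k < N) :
    ∑ i : Fin N, (if (i : ℕ) < k then (1 : ℝ) else 0) = k := by
  rw [Fin.sum_univ_eq_sum_range (fun i => if i < k then (1 : ℝ) else 0) N, ← Finset.sum_filter]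
  have : Finset.filter (fun i => i < k) (Finset.range N) = Finset.range k := by
    ext i; simp; omega
  rw [this]; simp

theorem bridgeVec_dot (N k : ℕ) (hk : k < N) (y : Fin N → ℝ) :
    ∑ i, bridgeVec N k i * y i = N / (N - k) *
      ((∑ i : Fin N, if (i : ℕ) < k then y i else 0) - k / N * ∑ i, y i) := by
  have hN0 : (N : ℝ) ≠ 0 := by exact_mod_cast (by omega : N ≠ 0)
  have hk' : (N : ℝ) - k ≠ 0 := by
    have : (k : ℝ) < N := by exact_mod_cast hk
    linarith
  rw [Finset.mul_sum, ← Finset.sum_sub_distrib, Finset.mul_sum]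
  refine Finset.sum_congr rfl fun i _ => ?_
  simp only [bridgeVec]
  split_ifs <;> field_simp <;> ring

theorem bridgeVec_sum (N k : ℕ) (hk : k < N) : ∑ i, bridgeVec N k i = 0 := by
  have h := bridgeVec_dot N k hk (fun _ => 1)
  have hN0 : (N : ℝ) ≠ 0 := by exact_mod_cast (by omega : N ≠ 0)
  rw [sum_ind N k hk] at h
  simpa [hN0] using h

theorem bridgeVec_inner (N j k : ℕ) (hjk : j ≤ k) (hk : k < N) :
    ∑ i, bridgeVec N j i * bridgeVec N k i = N * j / (N - j) := by
  have hN0 : (N : ℝ) ≠ 0 := by exact_mod_cast (by omega : N ≠ 0)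
  have hkr : (k : ℝ) < N := by exact_mod_cast hk
  have hjr : (j : ℝ) ≤ k := by exact_mod_cast hjk
  have hk' : (N : ℝ) - k ≠ 0 := by linarith
  have hj' : (N : ℝ) - j ≠ 0 := by linarith
  rw [bridgeVec_dot N j (by omega), bridgeVec_sum N k hk, mul_zero, sub_zero]
  have : ∀ i : Fin N, (if (i : ℕ) < j then bridgeVec N k i else 0)
      = (if (i : ℕ) < j then (1 : ℝ) else 0) := by
    intro i
    split_ifs with h
    · simp only [bridgeVec, if_pos (lt_of_lt_of_le h hjk)]
      field_simp
    · rfl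
  rw [Finset.sum_congr rfl fun i _ => this i, sum_ind N j (by omega)]
  ring

/-- One-dimensional Cameron-Martin density. -/
theorem gauss_tilt (μ s : ℝ) (v : NNReal) (hv : v ≠ 0) :
    (gaussianReal μ v).withDensity
      (fun x => ENNReal.ofReal (Real.exp (s * (x - μ) / v - s ^ 2 / (2 * v))))
      = (gaussianReal μ v).map (fun x => x + s) := by
  rw [gaussianReal_map_add_const, gaussianReal_of_var_ne_zero _ hv,
    gaussianReal_of_var_ne_zero _ hv, ← withDensity_mul _ (measurable_gaussianPDF _ _) (by fun_prop)]
  congr 1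
  ext x
  have hv' : (v : ℝ) ≠ 0 := by exact_mod_cast hv
  simp only [Pi.mul_apply, gaussianPDF, gaussianPDFReal]
  rw [← ENNReal.ofReal_mul (by positivity), mul_assoc, ← Real.exp_add]
  congr 3
  field_simp
  ring

theorem pi_tilt {N : ℕ} (μ : ℝ) (v : NNReal) (hv : v ≠ 0) (s : Fin N → ℝ) :
    (Measure.pi fun _ : Fin N => gaussianReal μ v).withDensity
      (fun x => ∏ i, ENNReal.ofReal (Real.exp (s i * (x i - μ) / v - s i ^ 2 / (2 * v))))
      = (Measure.pi fun _ : Fin N => gaussianReal μ v).map (fun x i => x i + s i) := by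
  have hprob : ∀ i, IsProbabilityMeasure ((gaussianReal μ v).map (fun x => x + s i)) := fun i =>
    Measure.isProbabilityMeasure_map (by fun_prop)
  rw [Measure.pi_map_pi (f := fun i x => x + s i) (fun i => by fun_prop)]
  symm
  refine Measure.pi_eq fun t ht => ?_
  rw [withDensity_apply _ (MeasurableSet.univ_pi ht), ← lintegral_indicator (MeasurableSet.univ_pi ht)]
  let X : Fin N → ℝ → ENNReal := fun i => (t i).indicator
    (fun x => ENNReal.ofReal (Real.exp (s i * (x - μ) / v - s i ^ 2 / (2 * v))))
  have hX : ∀ i, Measurable (X i) := fun i => Measurable.indicator (by fun_prop) (ht i)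
  have h1 : ∀ x : Fin N → ℝ, (Set.univ.pi t).indicator
      (fun x => ∏ i, ENNReal.ofReal (Real.exp (s i * (x i - μ) / v - s i ^ 2 / (2 * v)))) x
      = ∏ i, X i (x i) := by
    intro x
    by_cases hx : x ∈ Set.univ.pi t
    · rw [Set.indicator_of_mem hx]
      refine Finset.prod_congr rfl fun i _ => ?_
      simp only [X]
      rw [Set.indicator_of_mem (hx i trivial)]
    · rw [Set.indicator_of_notMem hx]
      simp only [Set.mem_univ_pi, not_forall] at hx
      obtain ⟨i, hi⟩ := hx
      exact (Finset.prod_eq_zero (Finset.mem_univ i) (Set.indicator_of_notMem hi _)).symm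
  rw [lintegral_congr h1]
  refine (lintegral_prod_eq_prod_lintegral_of_indepFun Finset.univ
    (fun i (x : Fin N → ℝ) => X i (x i)) (iIndepFun_pi fun i => (hX i).aemeasurable)
    (fun i => (hX i).comp (measurable_pi_apply i))).trans ?_
  refine Finset.prod_congr rfl fun i _ => ?_
  rw [← gauss_tilt μ (s i) v hv, withDensity_apply _ (ht i), ← lintegral_indicator (ht i)]
  exact (measurePreserving_eval (fun _ : Fin N => gaussianReal μ v) i).lintegral_comp (hX i)

/-- Ville-type maximal inequality for Gaussian linear functionals with independent increments,
proved by exponential tilting. -/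
theorem crossing_bound {N : ℕ} (μ : ℝ) (v : NNReal) (hv : v ≠ 0) (w : ℕ → Fin N → ℝ)
    (q c : ℕ → ℝ) (n : ℕ) (θ K : ℝ) (hθ : 0 ≤ θ)
    (hsum : ∀ k < n, ∑ i, w k i = 0)
    (hin : ∀ j k, j ≤ k → k < n → ∑ i, w j i * w k i = q j)
    (hK : ∀ k < n, K ≤ (θ * c k - θ ^ 2 * q k / 2) / v) :
    (Measure.pi fun _ : Fin N => gaussianReal μ v)
      {ω | ∃ k < n, c k < ∑ i, w k i * ω i} ≤ ENNReal.ofReal (Real.exp (-K)) := by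
  set Pm := (Measure.pi fun _ : Fin N => gaussianReal μ v) with hPm
  let A : ℕ → Set (Fin N → ℝ) := fun k =>
    {ω | c k < ∑ i, w k i * ω i ∧ ∀ j < k, ∑ i, w j i * ω i ≤ c j}
  have hA : ∀ k, MeasurableSet (A k) := by
    intro k
    have hm1 : MeasurableSet {ω : Fin N → ℝ | c k < ∑ i, w k i * ω i} :=
      measurableSet_lt (by fun_prop) (by fun_prop)
    refine MeasurableSet.inter hm1 ?_
    have : {ω : Fin N → ℝ | ∀ j < k, ∑ i, w j i * ω i ≤ c j}
      = ⋂ j, ⋂ (_ : j < k), {ω : Fin N → ℝ | ∑ i, w j i * ω i ≤ c j} := by ext; simp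
    change MeasurableSet {ω : Fin N → ℝ | ∀ j < k, ∑ i, w j i * ω i ≤ c j}
    rw [this]
    exact MeasurableSet.iInter fun j => MeasurableSet.iInter fun _ =>
      measurableSet_le (by fun_prop) (by fun_prop)
  have hdisj : Pairwise (Function.onFun Disjoint A) := by
    have hlt : ∀ j k, j < k → Disjoint (A j) (A k) := by
      intro j k hjk
      rw [Set.disjoint_left]
      intro ω h1 h2
      exact absurd h1.1 (not_lt.mpr (h2.2 j hjk))
    intro j k hjk
    rcases lt_or_gt_of_ne hjk with h | h
    · exact hlt j k h
    · exact (hlt k j h).symm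
  have hsub : {ω : Fin N → ℝ | ∃ k < n, c k < ∑ i, w k i * ω i} ⊆ ⋃ k ∈ Finset.range n, A k := by
    rintro ω ⟨k, hk, hck⟩
    classical
    have hex : ∃ k, c k < ∑ i, w k i * ω i := ⟨k, hck⟩
    simp only [Set.mem_iUnion, Finset.mem_range]
    refine ⟨Nat.find hex, lt_of_le_of_lt (Nat.find_min' hex hck) hk, Nat.find_spec hex, ?_⟩
    intro j hj
    exact not_lt.mp (Nat.find_min hex hj)
  have hv' : (0 : ℝ) < v := by exact_mod_cast pos_iff_ne_zero.mpr hv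
  let T : ℕ → (Fin N → ℝ) → (Fin N → ℝ) := fun k x i => x i + θ * w k i
  have hT : ∀ k, Measurable (T k) := fun k => by fun_prop
  -- the tilted bound
  have hstep : ∀ k < n, Pm (A k) ≤ ENNReal.ofReal (Real.exp (-K)) * Pm (T k ⁻¹' A k) := by
    intro k hk
    have h1 : Pm (T k ⁻¹' A k) = ∫⁻ x in A k, ∏ i, ENNReal.ofReal
        (Real.exp ((θ * w k i) * (x i - μ) / v - (θ * w k i) ^ 2 / (2 * v))) ∂Pm := by
      rw [← withDensity_apply _ (hA k), pi_tilt μ v hv, Measure.map_apply (hT k) (hA k)]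
    have h2 : ENNReal.ofReal (Real.exp K) * Pm (A k) ≤ Pm (T k ⁻¹' A k) := by
      rw [h1, ← setLIntegral_const]
      refine setLIntegral_mono' (hA k) fun x hx => ?_
      rw [← ENNReal.ofReal_prod_of_nonneg (fun i _ => (Real.exp_pos _).le), ← Real.exp_sum]
      refine ENNReal.ofReal_le_ofReal (Real.exp_le_exp.mpr ((hK k hk).trans ?_))
      have e1 : ∑ i, ((θ * w k i) * (x i - μ) / v - (θ * w k i) ^ 2 / (2 * v))
          = (θ * ∑ i, w k i * x i - θ * μ * ∑ i, w k i - θ ^ 2 * (∑ i, w k i * w k i) / 2) / v := by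
        simp only [Finset.mul_sum, Finset.sum_div, ← Finset.sum_sub_distrib]
        refine Finset.sum_congr rfl fun i _ => ?_
        field_simp
      rw [e1, hsum k hk, hin k k le_rfl hk]
      have := mul_le_mul_of_nonneg_left hx.1.le hθ
      gcongr
      linarith
    calc Pm (A k) = ENNReal.ofReal (Real.exp (-K)) * (ENNReal.ofReal (Real.exp K) * Pm (A k)) := by
          rw [← mul_assoc, ← ENNReal.ofReal_mul (Real.exp_pos _).le, ← Real.exp_add]
          simp
      _ ≤ _ := by gcongr
  have hpre : ∀ k < n, T k ⁻¹' A k = T (n - 1) ⁻¹' A k := by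
    intro k hk
    have hval : ∀ l j, j ≤ l → l < n → ∀ x : Fin N → ℝ,
        ∑ i, w j i * T l x i = ∑ i, w j i * x i + θ * q j := by
      intro l j hjl hl x
      rw [← hin j l hjl hl, Finset.mul_sum, ← Finset.sum_add_distrib]
      exact Finset.sum_congr rfl fun i _ => by simp only [T]; ring
    ext x
    simp only [A, Set.mem_preimage, Set.mem_ofPred_eq]
    rw [hval k k le_rfl hk, hval (n - 1) k (by omega) (by omega)]
    refine and_congr_right fun _ => forall₂_congr fun j hj => ?_
    rw [hval k j hj.le hk, hval (n - 1) j (by omega) (by omega)]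
  calc Pm {ω | ∃ k < n, c k < ∑ i, w k i * ω i} ≤ Pm (⋃ k ∈ Finset.range n, A k) := measure_mono hsub
    _ ≤ ∑ k ∈ Finset.range n, Pm (A k) := measure_biUnion_finset_le _ _
    _ ≤ ∑ k ∈ Finset.range n, ENNReal.ofReal (Real.exp (-K)) * Pm (T (n - 1) ⁻¹' A k) :=
        Finset.sum_le_sum fun k hk => by
          have hk := Finset.mem_range.mp hk
          rw [← hpre k hk]; exact hstep k hk
    _ = ENNReal.ofReal (Real.exp (-K)) * Pm (⋃ k ∈ Finset.range n, T (n - 1) ⁻¹' A k) := by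
        rw [← Finset.mul_sum, measure_biUnion_finset]
        · intro j _ k _ hjk
          exact (hdisj hjk).preimage _
        · exact fun k _ => hT _ (hA k)
    _ ≤ ENNReal.ofReal (Real.exp (-K)) * 1 := by gcongr; exact prob_le_one
    _ = _ := mul_one _

/-- Property 2: with `Yᵢ = μ + εᵢ`, `εᵢ` i.i.d. `N(0,σ²)`, and the
universal threshold `λ_N = (σ/2)√(N log log N)`, the 1D TV estimate equals the constant
fit `Ȳ𝟙` with probability at least `1 − 2/√(log N)`. -/
theorem tv_universal_threshold_constant_fit
    (N : ℕ) (hN : 3 ≤ N) (σ μ : ℝ) (hσ : 0 < σ) :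
    ENNReal.ofReal (1 - 2 / Real.sqrt (Real.log N)) ≤
      (Measure.pi fun _ : Fin N => gaussianReal μ ⟨σ ^ 2, sq_nonneg σ⟩)
        {ω : Fin N → ℝ | ∀ f : Fin N → ℝ,
          tvF (oneDiff N) (σ / 2 * Real.sqrt ((N : ℝ) * Real.log (Real.log N))) ω
              (fun _ => (∑ k, ω k) / (N : ℝ)) ≤
            tvF (oneDiff N) (σ / 2 * Real.sqrt ((N : ℝ) * Real.log (Real.log N))) ω f} := by
  set Pm := (Measure.pi fun _ : Fin N => gaussianReal μ ⟨σ ^ 2, sq_nonneg σ⟩) with hPm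
  have hprob : IsProbabilityMeasure Pm := by
    have h1 (v : NNReal) : IsProbabilityMeasure (Measure.pi fun _ : Fin N => gaussianReal μ v) :=
      inferInstance
    exact h1 _
  have hN0 : (0 : ℝ) < N := by exact_mod_cast (by omega : 0 < N)
  have hlog : 1 ≤ Real.log N := by
    rw [Real.le_log_iff_exp_le hN0]
    have h3 : (3 : ℝ) ≤ N := by exact_mod_cast hN
    linarith [Real.exp_one_lt_d9]
  have hL : 0 ≤ Real.log (Real.log N) := Real.log_nonneg hlog
  set L := Real.log (Real.log N) with hLdef
  set lam := σ / 2 * Real.sqrt ((N : ℝ) * L) with hlam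
  have hlam0 : 0 ≤ lam := by positivity
  have hlamsq : lam ^ 2 = σ ^ 2 / 4 * (N * L) := by
    rw [hlam, mul_pow, Real.sq_sqrt (by positivity)]; ring
  have hv : (⟨σ ^ 2, sq_nonneg σ⟩ : NNReal) ≠ 0 := by
    intro h
    have := congrArg NNReal.toReal h
    have h2 : σ ^ 2 = 0 := this
    exact hσ.ne' (pow_eq_zero_iff (two_ne_zero) |>.mp h2)
  have hexp : Real.exp (-(L / 2)) = 1 / Real.sqrt (Real.log N) := by
    rw [Real.exp_neg, one_div, Real.exp_half, hLdef, Real.exp_log (by linarith)]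
  have key : ∀ e : ℝ, e ^ 2 = 1 →
      Pm {ω | ∃ k < N, lam * (N / (N - k)) < ∑ i, (e * bridgeVec N k i) * ω i}
        ≤ ENNReal.ofReal (1 / Real.sqrt (Real.log N)) := by
    intro e he
    rw [← hexp]
    refine crossing_bound μ _ hv (fun k i => e * bridgeVec N k i) (fun k => N * k / (N - k))
      (fun k => lam * (N / (N - k))) N (2 * lam / N) (L / 2) (by positivity) ?_ ?_ ?_
    · intro k hk
      rw [← Finset.mul_sum, bridgeVec_sum N k hk, mul_zero]
    · intro j k hjk hk
      rw [← bridgeVec_inner N j k hjk hk]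
      refine Finset.sum_congr rfl fun i _ => ?_
      linear_combination (bridgeVec N j i * bridgeVec N k i) * he
    · intro k hk
      have hk' : (0 : ℝ) < N - k := by
        have : (k : ℝ) < N := by exact_mod_cast hk
        linarith
      apply le_of_eq
      change L / 2 = _ / (σ ^ 2)
      field_simp
      rw [hlamsq]
      ring
  set G : Set (Fin N → ℝ) := {ω | ∀ f : Fin N → ℝ,
          tvF (oneDiff N) lam ω (fun _ => (∑ k, ω k) / (N : ℝ)) ≤ tvF (oneDiff N) lam ω f}
  set U1 := {ω : Fin N → ℝ | ∃ k < N, lam * (N / (N - k)) < ∑ i, ((1:ℝ) * bridgeVec N k i) * ω i}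
  set U2 := {ω : Fin N → ℝ | ∃ k < N, lam * (N / (N - k)) < ∑ i, ((-1:ℝ) * bridgeVec N k i) * ω i}
  have hcover : (Set.univ : Set (Fin N → ℝ)) ⊆ G ∪ (U1 ∪ U2) := by
    intro ω _
    by_cases h : ω ∈ U1 ∪ U2
    · exact Or.inr h
    · left
      intro f
      refine tv_det N (by omega) lam ω ?_ f
      intro k hk
      have hk' : (0 : ℝ) < N - k := by
        have : (k : ℝ) < N := by exact_mod_cast hk
        linarith
      have h1 : ∑ i, bridgeVec N k i * ω i ≤ lam * (N / (N - k)) := by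
        by_contra hc
        exact h (Or.inl ⟨k, hk, by simpa using hc⟩)
      have h2 : -∑ i, bridgeVec N k i * ω i ≤ lam * (N / (N - k)) := by
        by_contra hc
        exact h (Or.inr ⟨k, hk, by simpa using hc⟩)
      rw [bridgeVec_dot N k hk] at h1 h2
      have hp : (0 : ℝ) < N / (N - k) := by positivity
      rw [abs_le]
      constructor
      · rw [← mul_neg, mul_comm lam] at h2
        linarith [le_of_mul_le_mul_left h2 hp]
      · rw [mul_comm lam] at h1
        exact le_of_mul_le_mul_left h1 hp
  have htot : 1 ≤ Pm G + (ENNReal.ofReal (1 / Real.sqrt (Real.log N)) + ENNReal.ofReal (1 / Real.sqrt (Real.log N))) := by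
    calc (1 : ENNReal) = Pm Set.univ := measure_univ.symm
      _ ≤ Pm (G ∪ (U1 ∪ U2)) := measure_mono hcover
      _ ≤ Pm G + Pm (U1 ∪ U2) := measure_union_le _ _
      _ ≤ Pm G + (Pm U1 + Pm U2) := by gcongr; exact measure_union_le _ _
      _ ≤ _ := by
        gcongr
        · exact key 1 (by norm_num)
        · exact key (-1) (by norm_num)
  rw [← ENNReal.ofReal_add (by positivity) (by positivity)] at htot
  rw [ENNReal.ofReal_sub _ (by positivity), ENNReal.ofReal_one, tsub_le_iff_right]
  refine htot.trans_eq ?_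
  congr 2
  ring
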